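/- arXiv:1201.0743 — 2 statements merged into one kernel-verified Lean document; each statement's English description precedes it below -/
import Mathlib

section
/- Let ρ > 0 and let j = (j₁,j₂) ∈ ℤ² satisfy λ_j = 0 and j₂ ≥ 1. Then the function x ↦ G_{k,α}(x) · conj(φ_j(x)), which is defined for almost every x ∈ Ω_ρ (namely for all x with x₂ ≠ 0), is Lebesgue integrable on Ω_ρ, and ∫_{Ω_ρ} G_{k,α}(x) conj(φ_j(x)) dx = (i/(4 j₂)) (ρ/π)^{3/2}. -/
open MeasureTheory

/-- `β_n = (k² − (n+α)²)^{1/2}`, the principal complex square root: positive real when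
`k² > (n+α)²`, and `i((n+α)² − k²)^{1/2}` when `k² < (n+α)²`. -/
noncomputable def greenBeta (k α : ℝ) (n : ℤ) : ℂ :=
  if k ^ 2 < ((n : ℝ) + α) ^ 2 then
    Complex.I * (Real.sqrt (((n : ℝ) + α) ^ 2 - k ^ 2) : ℂ)
  else (Real.sqrt (k ^ 2 - ((n : ℝ) + α) ^ 2) : ℂ)

/-- The `n`-th term `(1/β_n) exp(i α_n x₁ + i β_n |x₂|)` of the series for `G_{k,α}`. -/
noncomputable def greenTerm (k α : ℝ) (n : ℤ) (x : ℝ × ℝ) : ℂ :=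
  (1 / greenBeta k α n) *
    Complex.exp (Complex.I * ((((n : ℝ) + α) * x.1 : ℝ) : ℂ) +
      Complex.I * greenBeta k α n * ((|x.2| : ℝ) : ℂ))

/-- The quasi-periodic Green's function `G_{k,α}(x) = (i/(4π)) Σ_{n∈ℤ} greenTerm k α n x`. -/
noncomputable def greenFun (k α : ℝ) (x : ℝ × ℝ) : ℂ :=
  (Complex.I / (4 * (Real.pi : ℂ))) * ∑' n : ℤ, greenTerm k α n x

/-- The orthonormal trigonometric polynomials
`φ_j(x) = (4πρ)^{−1/2} exp(i((j₁+α)x₁ + (j₂π/ρ)x₂))`. -/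
noncomputable def phiFun (α ρ : ℝ) (j : ℤ × ℤ) (x : ℝ × ℝ) : ℂ :=
  (1 / (Real.sqrt (4 * Real.pi * ρ) : ℂ)) *
    Complex.exp (Complex.I *
      (((((j.1 : ℝ) + α) * x.1) + ((j.2 : ℝ) * Real.pi / ρ) * x.2 : ℝ) : ℂ))

/-- `λ_j = k² − (j₁+α)² − (j₂π/ρ)²`. -/
noncomputable def lamFun (k α ρ : ℝ) (j : ℤ × ℤ) : ℝ :=
  k ^ 2 - ((j.1 : ℝ) + α) ^ 2 - ((j.2 : ℝ) * Real.pi / ρ) ^ 2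

/-- The period cell `Ω_ρ = (−π,π) × (−ρ,ρ)`. -/
def OmegaRho (ρ : ℝ) : Set (ℝ × ℝ) := Set.Ioo (-Real.pi) Real.pi ×ˢ Set.Ioo (-ρ) ρ

/-- A series of functions whose `L¹` norms are summable has an integrable sum. -/
theorem integrable_tsum_of_summable_integral_norm {X : Type*} [MeasurableSpace X]
    {μ : Measure X} {ι : Type*} [Countable ι] {F : ι → X → ℂ}
    (hF_int : ∀ i, Integrable (F i) μ) (hF_sum : Summable fun i ↦ ∫ a, ‖F i a‖ ∂μ) :
    Integrable (fun a ↦ ∑' i, F i a) μ := by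
  refine ⟨(AEMeasurable.tsum fun i ↦ (hF_int i).1.aemeasurable).aestronglyMeasurable, ?_⟩
  have hle : ∫⁻ a, ‖∑' i, F i a‖ₑ ∂μ ≤ ∑' i, ∫⁻ a, ‖F i a‖ₑ ∂μ := by
    rw [← lintegral_tsum fun i ↦ (hF_int i).1.enorm]
    exact lintegral_mono fun a ↦ enorm_tsum_le_tsum_enorm
  refine hle.trans_lt ?_
  simp_rw [← fun i ↦ ofReal_integral_norm_eq_lintegral_enorm (hF_int i)]
  exact hF_sum.tsum_ofReal_lt_top

theorem integral_exp_neg_mul_abs {b : ℝ} (hb : 0 < b) :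
    ∫ y : ℝ, Real.exp (-b * |y|) = 2 / b := by
  rw [integral_comp_abs (f := fun y ↦ Real.exp (-b * y)),
    integral_exp_mul_Ioi (neg_lt_zero.mpr hb)]
  simp
  ring

theorem setIntegral_exp_neg_mul_abs_le {b : ℝ} (hb : 0 < b) (s : Set ℝ) :
    ∫ y in s, Real.exp (-b * |y|) ≤ 2 / b := by
  rw [← integral_exp_neg_mul_abs hb]
  refine setIntegral_le_integral (not_imp_comm.1 integral_undef ?_)
    (Filter.Eventually.of_forall fun _ ↦ (Real.exp_pos _).le)
  rw [integral_exp_neg_mul_abs hb]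
  positivity

/-- Orthogonality of the characters `x ↦ exp(imx)` on `(−π, π)`. -/
theorem setIntegral_exp_int_mul_I (m : ℤ) :
    ∫ x in Set.Ioo (-Real.pi) Real.pi, Complex.exp (Complex.I * m * (x : ℂ)) =
      if m = 0 then 2 * (Real.pi : ℂ) else 0 := by
  rw [← integral_Ioc_eq_integral_Ioo,
    ← intervalIntegral.integral_of_le (by linarith [Real.pi_pos])]
  split_ifs with hm
  · simp [hm]
    ring
  · have hc : Complex.I * (m : ℂ) ≠ 0 := by simp [hm]
    have hexp : Complex.exp (Complex.I * m * (Real.pi : ℂ)) =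
        Complex.exp (Complex.I * m * ((-Real.pi : ℝ) : ℂ)) := by
      refine Complex.exp_eq_exp_iff_exists_int.2 ⟨m, ?_⟩
      push_cast
      ring
    rw [integral_exp_mul_complex hc, hexp, sub_self, zero_div]

/-- For `bρ ∈ πℤ` the oscillating part of `exp(ib|y|) exp(−iby)` integrates to zero. -/
theorem setIntegral_exp_abs_mul_exp_neg {b ρ : ℝ} (hb : b ≠ 0) (hρ : 0 < ρ) {m : ℤ}
    (hm : b * ρ = m * Real.pi) :
    ∫ y in Set.Ioo (-ρ) ρ, Complex.exp (Complex.I * (b : ℂ) * ((|y| : ℝ) : ℂ)) *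
      Complex.exp (-(Complex.I * (b : ℂ) * (y : ℂ))) = (ρ : ℂ) := by
  rw [← integral_Ioc_eq_integral_Ioo, ← intervalIntegral.integral_of_le (by linarith)]
  have hcont : Continuous fun y : ℝ ↦ Complex.exp (Complex.I * (b : ℂ) * ((|y| : ℝ) : ℂ)) *
      Complex.exp (-(Complex.I * (b : ℂ) * (y : ℂ))) := by fun_prop
  rw [← intervalIntegral.integral_add_adjacent_intervals (hcont.intervalIntegrable (-ρ) 0)
    (hcont.intervalIntegrable 0 ρ)]
  have hneg : ∫ y in (-ρ)..0, Complex.exp (Complex.I * (b : ℂ) * ((|y| : ℝ) : ℂ)) *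
      Complex.exp (-(Complex.I * (b : ℂ) * (y : ℂ))) =
      ∫ y in (-ρ)..0, Complex.exp (-2 * Complex.I * b * (y : ℂ)) := by
    refine intervalIntegral.integral_congr fun y hy ↦ ?_
    rw [Set.uIcc_of_le (by linarith)] at hy
    simp only [abs_of_nonpos hy.2]
    rw [← Complex.exp_add]
    congr 1
    push_cast
    ring
  have hpos : ∫ y in (0 : ℝ)..ρ, Complex.exp (Complex.I * (b : ℂ) * ((|y| : ℝ) : ℂ)) *
      Complex.exp (-(Complex.I * (b : ℂ) * (y : ℂ))) = ∫ y in (0 : ℝ)..ρ, (1 : ℂ) := by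
    refine intervalIntegral.integral_congr fun y hy ↦ ?_
    rw [Set.uIcc_of_le hρ.le] at hy
    simp only [abs_of_nonneg hy.1]
    rw [← Complex.exp_add, add_neg_cancel, Complex.exp_zero]
  have hmC : (b : ℂ) * ρ = m * Real.pi := by exact_mod_cast hm
  rw [hneg, hpos, integral_exp_mul_complex (by simpa using hb)]
  have hone : Complex.exp (-2 * Complex.I * b * ((-ρ : ℝ) : ℂ)) = 1 := by
    rw [Complex.exp_eq_one_iff]
    refine ⟨m, ?_⟩
    push_cast
    linear_combination 2 * Complex.I * hmC
  rw [hone]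
  simp

/-- The factor of `greenTerm k α n x * conj (phiFun α ρ j x)` that depends on `x.2`. -/
noncomputable def greenTransverse (k α ρ : ℝ) (j : ℤ × ℤ) (n : ℤ) (y : ℝ) : ℂ :=
  1 / greenBeta k α n * (1 / (Real.sqrt (4 * Real.pi * ρ) : ℂ)) *
    (Complex.exp (Complex.I * greenBeta k α n * ((|y| : ℝ) : ℂ)) *
      Complex.exp (-(Complex.I * (((j.2 : ℝ) * Real.pi / ρ : ℝ) : ℂ) * (y : ℂ))))

theorem continuous_greenTransverse (k α ρ : ℝ) (j : ℤ × ℤ) (n : ℤ) :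
    Continuous (greenTransverse k α ρ j n) := by
  unfold greenTransverse
  fun_prop

theorem greenTerm_mul_conj_phiFun (k α ρ : ℝ) (j : ℤ × ℤ) (n : ℤ) (x : ℝ × ℝ) :
    greenTerm k α n x * (starRingEnd ℂ) (phiFun α ρ j x) =
      Complex.exp (Complex.I * ((n - j.1 : ℤ) : ℂ) * (x.1 : ℂ)) *
        greenTransverse k α ρ j n x.2 := by
  unfold greenTerm phiFun greenTransverse
  rw [map_mul, ← Complex.exp_conj]
  simp only [map_mul, map_div₀, map_one, Complex.conj_ofReal, Complex.conj_I]
  rw [mul_mul_mul_comm, ← Complex.exp_add, mul_left_comm, ← Complex.exp_add, ← Complex.exp_add]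
  congr 2
  push_cast
  ring

theorem setIntegral_norm_greenTerm_mul (k α ρ : ℝ) (j : ℤ × ℤ) (n : ℤ) :
    ∫ x in OmegaRho ρ, ‖greenTerm k α n x * (starRingEnd ℂ) (phiFun α ρ j x)‖ =
      2 * Real.pi * ∫ y in Set.Ioo (-ρ) ρ, ‖greenTransverse k α ρ j n y‖ := by
  have hnorm (x : ℝ × ℝ) : ‖greenTerm k α n x * (starRingEnd ℂ) (phiFun α ρ j x)‖ =
      (fun _ : ℝ ↦ (1 : ℝ)) x.1 * ‖greenTransverse k α ρ j n x.2‖ := by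
    rw [greenTerm_mul_conj_phiFun, norm_mul, Complex.norm_exp]
    simp
  simp_rw [hnorm, OmegaRho, Measure.volume_eq_prod]
  rw [setIntegral_prod_mul (fun _ : ℝ ↦ (1 : ℝ)) fun y ↦ ‖greenTransverse k α ρ j n y‖]
  simp [Real.pi_pos.le]
  left
  ring

theorem norm_greenTransverse_of_lt {k α : ℝ} (ρ : ℝ) (j : ℤ × ℤ) {n : ℤ}
    (h : k ^ 2 < ((n : ℝ) + α) ^ 2) (y : ℝ) :
    ‖greenTransverse k α ρ j n y‖ =
      1 / Real.sqrt (((n : ℝ) + α) ^ 2 - k ^ 2) * (1 / Real.sqrt (4 * Real.pi * ρ)) *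
        Real.exp (-Real.sqrt (((n : ℝ) + α) ^ 2 - k ^ 2) * |y|) := by
  simp [greenTransverse, greenBeta, h, Complex.norm_exp, abs_of_nonneg (Real.sqrt_nonneg _)]

theorem setIntegral_norm_greenTransverse_le {k α : ℝ} (ρ : ℝ) (j : ℤ × ℤ) {n : ℤ}
    (h : k ^ 2 < ((n : ℝ) + α) ^ 2) :
    ∫ y in Set.Ioo (-ρ) ρ, ‖greenTransverse k α ρ j n y‖ ≤
      2 / Real.sqrt (4 * Real.pi * ρ) * (1 / (((n : ℝ) + α) ^ 2 - k ^ 2)) := by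
  simp_rw [norm_greenTransverse_of_lt ρ j h]
  have hb := Real.sqrt_pos.2 (sub_pos.2 h)
  have hsq := Real.sq_sqrt (sub_pos.2 h).le
  set b := Real.sqrt (((n : ℝ) + α) ^ 2 - k ^ 2)
  rw [integral_const_mul, ← hsq]
  calc _ ≤ 1 / b * (1 / Real.sqrt (4 * Real.pi * ρ)) * (2 / b) := by
        gcongr
        exact setIntegral_exp_neg_mul_abs_le hb _
    _ = _ := by field_simp

theorem finite_setOf_abs_int_add_le (α R : ℝ) : {n : ℤ | |(n : ℝ) + α| ≤ R}.Finite := by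
  refine (Set.finite_Icc ⌈-R - α⌉ ⌊R - α⌋).subset fun n hn ↦ ?_
  obtain ⟨h₁, h₂⟩ := abs_le.1 (Set.mem_ofPred_eq.le hn)
  exact ⟨Int.ceil_le.2 (by linarith), Int.le_floor.2 (by linarith)⟩

theorem summable_setIntegral_norm_greenTerm_mul {k : ℝ} (hk : 0 < k) (α ρ : ℝ) (j : ℤ × ℤ) :
    Summable fun n : ℤ ↦
      ∫ x in OmegaRho ρ, ‖greenTerm k α n x * (starRingEnd ℂ) (phiFun α ρ j x)‖ := by
  simp_rw [setIntegral_norm_greenTerm_mul]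
  refine Summable.mul_left _ ?_
  have hsum : Summable fun n : ℤ ↦
      2 / Real.sqrt (4 * Real.pi * ρ) * (2 * (1 / |(n : ℝ) + α| ^ (2 : ℝ))) :=
    (((Real.summable_one_div_int_add_rpow α 2).2 one_lt_two).mul_left 2).mul_left _
  refine hsum.of_norm_bounded_eventually ?_
  filter_upwards [(finite_setOf_abs_int_add_le α (2 * k)).compl_mem_cofinite] with n hn
  have hn' : 2 * k < |(n : ℝ) + α| := not_le.1 hn
  have hsq : 4 * k ^ 2 < ((n : ℝ) + α) ^ 2 := by
    rw [← sq_abs ((n : ℝ) + α)]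
    nlinarith
  rw [Real.norm_of_nonneg (integral_nonneg fun _ ↦ norm_nonneg _)]
  refine (setIntegral_norm_greenTransverse_le ρ j (by nlinarith)).trans ?_
  gcongr
  rw [Real.rpow_two, sq_abs, mul_one_div, div_le_div_iff₀ (by nlinarith) (by nlinarith)]
  nlinarith

theorem integrableOn_greenTerm_mul (k α ρ : ℝ) (j : ℤ × ℤ) (n : ℤ) :
    IntegrableOn (fun x ↦ greenTerm k α n x * (starRingEnd ℂ) (phiFun α ρ j x))
      (OmegaRho ρ) := by
  simp_rw [greenTerm_mul_conj_phiFun]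
  have hcont : Continuous fun x : ℝ × ℝ ↦
      Complex.exp (Complex.I * ((n - j.1 : ℤ) : ℂ) * (x.1 : ℂ)) *
        greenTransverse k α ρ j n x.2 := by
    have := continuous_greenTransverse k α ρ j n
    fun_prop
  exact (hcont.continuousOn.integrableOn_compact (isCompact_Icc.prod isCompact_Icc)).mono_set
    (Set.prod_mono Set.Ioo_subset_Icc_self Set.Ioo_subset_Icc_self)

theorem setIntegral_greenTerm_mul (k α ρ : ℝ) (j : ℤ × ℤ) (n : ℤ) :
    ∫ x in OmegaRho ρ, greenTerm k α n x * (starRingEnd ℂ) (phiFun α ρ j x) =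
      if n = j.1 then
        2 * (Real.pi : ℂ) * ∫ y in Set.Ioo (-ρ) ρ, greenTransverse k α ρ j j.1 y
      else 0 := by
  simp_rw [greenTerm_mul_conj_phiFun, OmegaRho, Measure.volume_eq_prod]
  rw [setIntegral_prod_mul (fun x : ℝ ↦ Complex.exp (Complex.I * ((n - j.1 : ℤ) : ℂ) * (x : ℂ)))
    (greenTransverse k α ρ j n), setIntegral_exp_int_mul_I]
  by_cases h : n = j.1
  · simp [h]
  · simp [h, sub_eq_zero]

theorem greenBeta_eq_of_lamFun_eq_zero {k α ρ : ℝ} (hρ : 0 < ρ) {j : ℤ × ℤ}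
    (hj : lamFun k α ρ j = 0) (hj2 : 1 ≤ j.2) :
    greenBeta k α j.1 = (((j.2 : ℝ) * Real.pi / ρ : ℝ) : ℂ) := by
  have hj2' : (0 : ℝ) < j.2 := by exact_mod_cast hj2
  have hb : 0 < (j.2 : ℝ) * Real.pi / ρ := by positivity
  have hsq : k ^ 2 - ((j.1 : ℝ) + α) ^ 2 = ((j.2 : ℝ) * Real.pi / ρ) ^ 2 := by
    unfold lamFun at hj
    linarith
  rw [greenBeta, if_neg (by nlinarith), hsq, Real.sqrt_sq hb.le]

theorem setIntegral_greenTransverse {k α ρ : ℝ} (hρ : 0 < ρ) {j : ℤ × ℤ}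
    (hj : lamFun k α ρ j = 0) (hj2 : 1 ≤ j.2) :
    ∫ y in Set.Ioo (-ρ) ρ, greenTransverse k α ρ j j.1 y =
      1 / (((j.2 : ℝ) * Real.pi / ρ : ℝ) : ℂ) * (1 / (Real.sqrt (4 * Real.pi * ρ) : ℂ)) * ρ := by
  have hj2' : (0 : ℝ) < j.2 := by exact_mod_cast hj2
  have hb : (j.2 : ℝ) * Real.pi / ρ ≠ 0 := by positivity
  simp_rw [greenTransverse, greenBeta_eq_of_lamFun_eq_zero hρ hj hj2]
  rw [integral_const_mul, setIntegral_exp_abs_mul_exp_neg hb hρ (m := j.2) (by field_simp)]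

theorem sq_div_pi_mul_sqrt_four_pi_mul {ρ : ℝ} (hρ : 0 < ρ) :
    ρ ^ 2 / (Real.pi * Real.sqrt (4 * Real.pi * ρ)) = (ρ / Real.pi) ^ (3 / 2 : ℝ) / 2 := by
  have hπ := Real.pi_pos
  have hq : 0 < ρ / Real.pi := by positivity
  have hsqrt : Real.sqrt (4 * Real.pi * ρ) = 2 * Real.pi * Real.sqrt (ρ / Real.pi) := by
    rw [Real.sqrt_eq_iff_mul_self_eq (by positivity) (by positivity),
      mul_mul_mul_comm, Real.mul_self_sqrt hq.le]
    field_simp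
    ring
  have hpow : (ρ / Real.pi) ^ (3 / 2 : ℝ) = ρ / Real.pi * Real.sqrt (ρ / Real.pi) := by
    rw [Real.sqrt_eq_rpow, ← Real.rpow_one_add' hq.le (by norm_num)]
    norm_num
  have hs := Real.sqrt_pos.2 hq
  have hss := Real.sq_sqrt hq.le
  rw [hsqrt, hpow]
  field_simp
  rw [hss]
  field_simp

/-- **Theorem 3.2, case `λ_j = 0`.** For `λ_j = 0` and `j₂ ≥ 1`, the function
`x ↦ G_{k,α}(x) conj(φ_j(x))` is integrable on `Ω_ρ` and
`∫_{Ω_ρ} G_{k,α} conj(φ_j) = (i/(4j₂)) (ρ/π)^{3/2}`. -/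
theorem fourierCoeff_green_eq_zero
    (k α : ℝ) (hk : 0 < k)
    (hres : ∀ n : ℤ, k ^ 2 ≠ ((n : ℝ) + α) ^ 2)
    (ρ : ℝ) (hρ : 0 < ρ) (j : ℤ × ℤ) (hj : lamFun k α ρ j = 0) (hj2 : 1 ≤ j.2) :
    IntegrableOn (fun x => greenFun k α x * (starRingEnd ℂ) (phiFun α ρ j x)) (OmegaRho ρ) ∧
    ∫ x in OmegaRho ρ, greenFun k α x * (starRingEnd ℂ) (phiFun α ρ j x) =
      (Complex.I / (4 * (j.2 : ℂ))) * (((ρ / Real.pi) ^ (3 / 2 : ℝ) : ℝ) : ℂ) := by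
  have hint := integrableOn_greenTerm_mul k α ρ j
  have hsum := summable_setIntegral_norm_greenTerm_mul hk α ρ j
  have hfun : (fun x ↦ greenFun k α x * (starRingEnd ℂ) (phiFun α ρ j x)) = fun x ↦
      Complex.I / (4 * (Real.pi : ℂ)) *
        ∑' n : ℤ, greenTerm k α n x * (starRingEnd ℂ) (phiFun α ρ j x) := by
    funext x
    rw [greenFun, tsum_mul_right, mul_assoc]
  rw [hfun]
  refine ⟨(integrable_tsum_of_summable_integral_norm hint hsum).const_mul _, ?_⟩
  rw [integral_const_mul, ← integral_tsum_of_summable_integral_norm hint hsum]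
  simp_rw [setIntegral_greenTerm_mul]
  rw [tsum_ite_eq, setIntegral_greenTransverse hρ hj hj2]
  have hj2' : (j.2 : ℂ) ≠ 0 := by exact_mod_cast (by omega : j.2 ≠ 0)
  have hπ : (Real.pi : ℂ) ≠ 0 := by exact_mod_cast Real.pi_ne_zero
  have hs : (Real.sqrt (4 * Real.pi * ρ) : ℂ) ≠ 0 := by
    have := Real.pi_pos
    exact_mod_cast (Real.sqrt_pos.2 (by positivity)).ne'
  have hρ' : (ρ : ℂ) ≠ 0 := by exact_mod_cast hρ.ne'
  have hval := congrArg (fun r : ℝ ↦ (r : ℂ)) (sq_div_pi_mul_sqrt_four_pi_mul hρ)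
  push_cast at hval ⊢
  calc _ = Complex.I / (2 * (j.2 : ℂ)) *
        ((ρ : ℂ) ^ 2 / (Real.pi * (Real.sqrt (4 * Real.pi * ρ) : ℂ))) := by
        field_simp
        ring
    _ = _ := by
        rw [hval]
        ring
end

section
/- Define g : {(x₁,x₂) ∈ ℝ² : x₂ > 0} → ℂ by g(x₁,x₂) := (i/(4π)) Σ_{n∈ℤ} (1/β_n) exp(i α_n x₁ + i β_n x₂). Then g is infinitely differentiable on the open upper half-plane {x₂ > 0} and satisfies the Helmholtz equation there: ∂²g/∂x₁² + ∂²g/∂x₂² + k² g = 0 at every point (x₁,x₂) with x₂ > 0. -/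
open MeasureTheory

/-- The series for `G_{k,α}` on the open upper half-plane (where `|x₂| = x₂`). -/
noncomputable def greenUpper (k α : ℝ) (x : ℝ × ℝ) : ℂ :=
  (Complex.I / (4 * (Real.pi : ℂ))) * ∑' n : ℤ,
    (1 / greenBeta k α n) *
      Complex.exp (Complex.I * ((((n : ℝ) + α) * x.1 : ℝ) : ℂ) +
        Complex.I * greenBeta k α n * ((x.2 : ℝ) : ℂ))

/-- The exponential series `Σ_n c_n exp(a_n x₁ + b_n x₂)`. -/
noncomputable def expSeries (a b c : ℤ → ℂ) (x : ℝ × ℝ) : ℂ :=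
  ∑' n : ℤ, c n * Complex.exp (a n * (x.1 : ℂ) + b n * (x.2 : ℂ))

/-- The coefficients `c` beat every power of the weight `w` after damping by `exp(ε Re b)`,
for each `ε > 0`. -/
def RapidDecay (w : ℤ → ℝ) (b c : ℤ → ℂ) : Prop :=
  ∀ (j : ℕ) (ε : ℝ), 0 < ε →
    Summable fun n : ℤ => ‖c n‖ * w n ^ j * Real.exp ((b n).re * ε)

lemma RapidDecay.mul {w : ℤ → ℝ} {b c d : ℤ → ℂ} (hc : RapidDecay w b c)
    (hd : ∀ n, ‖d n‖ ≤ w n) : RapidDecay w b (fun n => c n * d n) := by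
  intro j ε hε
  have hw : ∀ n, 0 ≤ w n := fun n => (norm_nonneg _).trans (hd n)
  refine (hc (j + 1) ε hε).of_nonneg_of_le (fun n => ?_) (fun n => ?_)
  · have := hw n
    positivity
  · have := hw n
    rw [norm_mul, pow_succ', ← mul_assoc ‖c n‖]
    gcongr
    exact hd n

lemma norm_expSeries_term_le {a b c : ℂ} (ha : a.re = 0) (hb : b.re ≤ 0) {ε : ℝ}
    {x : ℝ × ℝ} (hx : ε ≤ x.2) :
    ‖c * Complex.exp (a * (x.1 : ℂ) + b * (x.2 : ℂ))‖ ≤ ‖c‖ * Real.exp (b.re * ε) := by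
  rw [norm_mul, Complex.norm_exp]
  gcongr
  simpa [ha] using mul_le_mul_of_nonpos_left hx hb

lemma RapidDecay.summable_term {w : ℤ → ℝ} {a b c : ℤ → ℂ} (hc : RapidDecay w b c)
    (ha : ∀ n, (a n).re = 0) (hb : ∀ n, (b n).re ≤ 0) {x : ℝ × ℝ} (hx : 0 < x.2) :
    Summable fun n => c n * Complex.exp (a n * (x.1 : ℂ) + b n * (x.2 : ℂ)) :=
  (by simpa using hc 0 x.2 hx : Summable fun n => ‖c n‖ * Real.exp ((b n).re * x.2)).of_norm_bounded
    fun n => norm_expSeries_term_le (ha n) (hb n) le_rfl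

lemma hasFDerivAt_expSeries_term (a b c : ℂ) (x : ℝ × ℝ) :
    HasFDerivAt (fun x : ℝ × ℝ => c * Complex.exp (a * (x.1 : ℂ) + b * (x.2 : ℂ)))
      ((ContinuousLinearMap.fst ℝ ℝ ℝ).smulRight
          (c * a * Complex.exp (a * (x.1 : ℂ) + b * (x.2 : ℂ))) +
        (ContinuousLinearMap.snd ℝ ℝ ℝ).smulRight
          (c * b * Complex.exp (a * (x.1 : ℂ) + b * (x.2 : ℂ)))) x := by
  have h₁ : HasFDerivAt (fun x : ℝ × ℝ => (x.1 : ℂ))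
      (Complex.ofRealCLM.comp (ContinuousLinearMap.fst ℝ ℝ ℝ)) x :=
    (Complex.ofRealCLM.comp (ContinuousLinearMap.fst ℝ ℝ ℝ)).hasFDerivAt
  have h₂ : HasFDerivAt (fun x : ℝ × ℝ => (x.2 : ℂ))
      (Complex.ofRealCLM.comp (ContinuousLinearMap.snd ℝ ℝ ℝ)) x :=
    (Complex.ofRealCLM.comp (ContinuousLinearMap.snd ℝ ℝ ℝ)).hasFDerivAt
  refine (((h₁.const_mul a).add (h₂.const_mul b)).cexp.const_mul c).congr_fderiv ?_
  ext <;> simp <;> ring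

lemma hasFDerivAt_expSeries {w : ℤ → ℝ} {a b c : ℤ → ℂ} (hc : RapidDecay w b c)
    (ha : ∀ n, (a n).re = 0) (hb : ∀ n, (b n).re ≤ 0)
    (haw : ∀ n, ‖a n‖ ≤ w n) (hbw : ∀ n, ‖b n‖ ≤ w n) {x : ℝ × ℝ} (hx : 0 < x.2) :
    HasFDerivAt (expSeries a b c)
      ((ContinuousLinearMap.fst ℝ ℝ ℝ).smulRight (expSeries a b (fun n => c n * a n) x) +
        (ContinuousLinearMap.snd ℝ ℝ ℝ).smulRight (expSeries a b (fun n => c n * b n) x)) x := by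
  have hsa := hc.mul haw
  have hsb := hc.mul hbw
  have hu := (hsa 0 (x.2 / 2) (half_pos hx)).add (hsb 0 (x.2 / 2) (half_pos hx))
  have hopen : IsOpen {y : ℝ × ℝ | x.2 / 2 < y.2} := isOpen_lt continuous_const continuous_snd
  have hconv : Convex ℝ {y : ℝ × ℝ | x.2 / 2 < y.2} :=
    convex_halfSpace_gt (f := fun y : ℝ × ℝ => y.2) ⟨fun _ _ => rfl, fun _ _ => rfl⟩ _
  have hmem : x ∈ {y : ℝ × ℝ | x.2 / 2 < y.2} := half_lt_self hx
  have key := hasFDerivAt_tsum_of_isPreconnected hu hopen hconv.isPreconnected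
    (fun n y _ => hasFDerivAt_expSeries_term (a n) (b n) (c n) y)
    (fun n y hy => by
      refine (norm_add_le _ _).trans ?_
      rw [ContinuousLinearMap.norm_smulRight_apply, ContinuousLinearMap.norm_smulRight_apply]
      simp only [pow_zero, mul_one]
      have hy' : x.2 / 2 ≤ y.2 := le_of_lt hy
      refine add_le_add ?_ ?_
      · exact (mul_le_of_le_one_left (norm_nonneg _)
          (ContinuousLinearMap.norm_fst_le ℝ ℝ ℝ)).trans
          (norm_expSeries_term_le (ha n) (hb n) hy')
      · exact (mul_le_of_le_one_left (norm_nonneg _)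
          (ContinuousLinearMap.norm_snd_le ℝ ℝ ℝ)).trans
          (norm_expSeries_term_le (ha n) (hb n) hy'))
    hmem (hc.summable_term ha hb hx) hmem
  have h₁ := (hsa.summable_term ha hb hx).hasSum.mapL
    (ContinuousLinearMap.smulRightL ℝ (ℝ × ℝ) ℂ (ContinuousLinearMap.fst ℝ ℝ ℝ))
  have h₂ := (hsb.summable_term ha hb hx).hasSum.mapL
    (ContinuousLinearMap.smulRightL ℝ (ℝ × ℝ) ℂ (ContinuousLinearMap.snd ℝ ℝ ℝ))
  exact key.congr_fderiv (h₁.add h₂).tsum_eq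

lemma contDiffOn_expSeries {w : ℤ → ℝ} {a b : ℤ → ℂ}
    (ha : ∀ n, (a n).re = 0) (hb : ∀ n, (b n).re ≤ 0)
    (haw : ∀ n, ‖a n‖ ≤ w n) (hbw : ∀ n, ‖b n‖ ≤ w n) (m : ℕ) :
    ∀ c : ℤ → ℂ, RapidDecay w b c →
      ContDiffOn ℝ m (expSeries a b c) {x : ℝ × ℝ | 0 < x.2} := by
  have hopen : IsOpen {y : ℝ × ℝ | 0 < y.2} := isOpen_lt continuous_const continuous_snd
  induction m with
  | zero =>
    intro c hc
    exact contDiffOn_zero.2 fun x hx =>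
      (hasFDerivAt_expSeries hc ha hb haw hbw hx).continuousAt.continuousWithinAt
  | succ m ih =>
    intro c hc
    have hd := fun x (hx : 0 < x.2) => hasFDerivAt_expSeries (x := x) hc ha hb haw hbw hx
    push_cast
    refine (contDiffOn_succ_iff_fderiv_of_isOpen hopen).2
      ⟨fun x hx => (hd x hx).differentiableAt.differentiableWithinAt, by simp, ?_⟩
    refine ContDiffOn.congr ?_ fun x hx => (hd x hx).fderiv
    exact ((ContinuousLinearMap.smulRightL ℝ (ℝ × ℝ) ℂ
        (ContinuousLinearMap.fst ℝ ℝ ℝ)).contDiff.comp_contDiffOn (ih _ (hc.mul haw))).add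
      ((ContinuousLinearMap.smulRightL ℝ (ℝ × ℝ) ℂ
        (ContinuousLinearMap.snd ℝ ℝ ℝ)).contDiff.comp_contDiffOn (ih _ (hc.mul hbw)))

lemma hasDerivAt_expSeries_fst {w : ℤ → ℝ} {a b c : ℤ → ℂ} (hc : RapidDecay w b c)
    (ha : ∀ n, (a n).re = 0) (hb : ∀ n, (b n).re ≤ 0)
    (haw : ∀ n, ‖a n‖ ≤ w n) (hbw : ∀ n, ‖b n‖ ≤ w n) (s : ℝ) {t : ℝ} (ht : 0 < t) :
    HasDerivAt (fun s : ℝ => expSeries a b c (s, t))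
      (expSeries a b (fun n => c n * a n) (s, t)) s := by
  have h := (hasFDerivAt_expSeries (x := (s, t)) hc ha hb haw hbw ht).comp_hasDerivAt s
    ((hasDerivAt_id s).prodMk (hasDerivAt_const s t))
  simpa [Function.comp_def] using h

lemma hasDerivAt_expSeries_snd {w : ℤ → ℝ} {a b c : ℤ → ℂ} (hc : RapidDecay w b c)
    (ha : ∀ n, (a n).re = 0) (hb : ∀ n, (b n).re ≤ 0)
    (haw : ∀ n, ‖a n‖ ≤ w n) (hbw : ∀ n, ‖b n‖ ≤ w n) (s : ℝ) {t : ℝ} (ht : 0 < t) :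
    HasDerivAt (fun t : ℝ => expSeries a b c (s, t))
      (expSeries a b (fun n => c n * b n) (s, t)) t := by
  have h := (hasFDerivAt_expSeries (x := (s, t)) hc ha hb haw hbw ht).comp_hasDerivAt t
    ((hasDerivAt_const t s).prodMk (hasDerivAt_id t))
  simpa [Function.comp_def] using h

lemma expSeries_helmholtz {w : ℤ → ℝ} {a b c : ℤ → ℂ} (hc : RapidDecay w b c)
    (ha : ∀ n, (a n).re = 0) (hb : ∀ n, (b n).re ≤ 0)
    (haw : ∀ n, ‖a n‖ ≤ w n) (hbw : ∀ n, ‖b n‖ ≤ w n) {κ : ℂ}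
    (hκ : ∀ n, a n ^ 2 + b n ^ 2 + κ = 0) {x : ℝ × ℝ} (hx : 0 < x.2) :
    deriv (deriv (fun s : ℝ => expSeries a b c (s, x.2))) x.1 +
      deriv (deriv (fun t : ℝ => expSeries a b c (x.1, t))) x.2 +
      κ * expSeries a b c x = 0 := by
  have hca := hc.mul haw
  have hcb := hc.mul hbw
  have h₁ : deriv (fun s : ℝ => expSeries a b c (s, x.2)) =
      fun s => expSeries a b (fun n => c n * a n) (s, x.2) :=
    funext fun s => (hasDerivAt_expSeries_fst hc ha hb haw hbw s hx).deriv
  have h₂ : deriv (fun t : ℝ => expSeries a b c (x.1, t)) =ᶠ[nhds x.2]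
      fun t => expSeries a b (fun n => c n * b n) (x.1, t) := by
    filter_upwards [lt_mem_nhds hx] with t ht
    exact (hasDerivAt_expSeries_snd hc ha hb haw hbw x.1 ht).deriv
  rw [h₁, h₂.deriv_eq, (hasDerivAt_expSeries_fst hca ha hb haw hbw x.1 hx).deriv,
    (hasDerivAt_expSeries_snd hcb ha hb haw hbw x.1 hx).deriv]
  simp only [expSeries]
  rw [← tsum_mul_left, ← ((hca.mul haw).summable_term ha hb hx).tsum_add
      ((hcb.mul hbw).summable_term ha hb hx),
    ← (((hca.mul haw).summable_term ha hb hx).add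
      ((hcb.mul hbw).summable_term ha hb hx)).tsum_add
      ((hc.summable_term ha hb hx).mul_left κ)]
  refine (tsum_congr fun n => ?_).trans tsum_zero
  linear_combination (c n * Complex.exp (a n * (x.1 : ℂ) + b n * (x.2 : ℂ))) * hκ n

lemma greenBeta_sq (k α : ℝ) (n : ℤ) :
    greenBeta k α n ^ 2 = (k : ℂ) ^ 2 - ((n : ℂ) + α) ^ 2 := by
  unfold greenBeta
  split_ifs with h
  · rw [mul_pow, Complex.I_sq, ← Complex.ofReal_pow, Real.sq_sqrt (by linarith)]
    push_cast
    ring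
  · rw [← Complex.ofReal_pow, Real.sq_sqrt (by linarith)]
    push_cast
    ring

lemma norm_greenBeta_sq (k α : ℝ) (n : ℤ) :
    ‖greenBeta k α n‖ ^ 2 = |k ^ 2 - ((n : ℝ) + α) ^ 2| := by
  rw [← norm_pow, greenBeta_sq, ← Real.norm_eq_abs, ← Complex.norm_real]
  push_cast
  rfl

lemma norm_greenBeta_le {k : ℝ} (hk : 0 < k) (α : ℝ) (n : ℤ) :
    ‖greenBeta k α n‖ ≤ |(n : ℝ) + α| + k := by
  refine le_of_sq_le_sq ?_ (by positivity)
  rw [norm_greenBeta_sq, abs_le, ← sq_abs ((n : ℝ) + α)]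
  have := abs_nonneg ((n : ℝ) + α)
  constructor <;> nlinarith [mul_nonneg this hk.le]

lemma one_le_norm_greenBeta {k α : ℝ} (hk : 0 < k) {n : ℤ} (hn : k + 1 ≤ |(n : ℝ) + α|) :
    1 ≤ ‖greenBeta k α n‖ := by
  refine le_of_sq_le_sq ?_ (norm_nonneg _)
  rw [norm_greenBeta_sq, le_abs, ← sq_abs ((n : ℝ) + α)]
  right
  nlinarith

lemma re_I_mul_greenBeta_nonpos (k α : ℝ) (n : ℤ) : (Complex.I * greenBeta k α n).re ≤ 0 := by
  unfold greenBeta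
  split_ifs <;> simp

lemma re_I_mul_greenBeta_le {k : ℝ} (hk : 0 < k) (α : ℝ) (n : ℤ) :
    (Complex.I * greenBeta k α n).re ≤ k - |(n : ℝ) + α| := by
  unfold greenBeta
  split_ifs with h
  · have hle : |(n : ℝ) + α| - k ≤ √(((n : ℝ) + α) ^ 2 - k ^ 2) := by
      have hlt : k < |(n : ℝ) + α| :=
        lt_of_pow_lt_pow_left₀ 2 (abs_nonneg _) (by rwa [sq_abs])
      refine Real.le_sqrt_of_sq_le ?_
      rw [← sq_abs ((n : ℝ) + α)]
      nlinarith
    simp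
    linarith
  · simpa using abs_le_of_sq_le_sq (not_lt.1 h) hk.le

lemma summable_int_pow_mul_exp_neg (j N : ℕ) {ε : ℝ} (hε : 0 < ε) :
    Summable fun n : ℤ => (|(n : ℝ)| + N) ^ j * Real.exp (-ε * |(n : ℝ)|) := by
  have hnat : Summable fun n : ℕ => ((n : ℝ) + N) ^ j * Real.exp (-ε * n) := by
    have h := ((summable_nat_add_iff N).2
      (Real.summable_pow_mul_exp_neg_nat_mul j hε)).mul_right (Real.exp (ε * N))
    refine h.congr fun n => ?_
    rw [mul_assoc, ← Real.exp_add]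
    push_cast
    ring_nf
  refine Summable.of_nat_of_neg ?_ ?_ <;> simpa using hnat

lemma rapidDecay_greenBeta {k : ℝ} (hk : 0 < k) (α : ℝ) (C : ℂ) :
    RapidDecay (fun n => |(n : ℝ) + α| + k) (fun n => Complex.I * greenBeta k α n)
      (fun n => C * (1 / greenBeta k α n)) := by
  intro j ε hε
  obtain ⟨N, hN⟩ := exists_nat_ge (|α| + k)
  have hfin : ∀ᶠ n : ℤ in Filter.cofinite, k + 1 ≤ |(n : ℝ) + α| := by
    refine (Set.finite_Icc (-(N : ℤ) - 1) (N + 1)).subset fun n hn => ?_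
    have hn' : |(n : ℝ) + α| < k + 1 := not_le.1 hn
    have hlt : |(n : ℝ)| ≤ N + 1 := by
      have := abs_sub_abs_le_abs_sub (n : ℝ) (-α)
      rw [abs_neg, sub_neg_eq_add] at this
      linarith
    obtain ⟨h₁, h₂⟩ := abs_le.1 hlt
    exact ⟨by exact_mod_cast (by linarith : -(N : ℝ) - 1 ≤ n), by exact_mod_cast h₂⟩
  refine Summable.of_norm_bounded_eventually
    ((summable_int_pow_mul_exp_neg j N hε).mul_left (‖C‖ * Real.exp (ε * N))) ?_
  filter_upwards [hfin] with n hn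
  have hβ : ‖C * (1 / greenBeta k α n)‖ ≤ ‖C‖ := by
    rw [norm_mul, norm_div, norm_one]
    exact mul_le_of_le_one_right (norm_nonneg _)
      (div_le_one_of_le₀ (one_le_norm_greenBeta hk hn) (norm_nonneg _))
  have hw : |(n : ℝ) + α| + k ≤ |(n : ℝ)| + N := by
    linarith [abs_add_le (n : ℝ) α]
  have hexp : (Complex.I * greenBeta k α n).re * ε ≤ ε * N + -ε * |(n : ℝ)| := by
    have := abs_sub_abs_le_abs_sub (n : ℝ) (-α)
    rw [abs_neg, sub_neg_eq_add] at this
    have hre : (Complex.I * greenBeta k α n).re ≤ N - |(n : ℝ)| := by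
      linarith [re_I_mul_greenBeta_le hk α n]
    nlinarith
  rw [Real.norm_of_nonneg (by positivity)]
  calc ‖C * (1 / greenBeta k α n)‖ * (|(n : ℝ) + α| + k) ^ j *
        Real.exp ((Complex.I * greenBeta k α n).re * ε)
      ≤ ‖C‖ * (|(n : ℝ)| + N) ^ j * Real.exp (ε * N + -ε * |(n : ℝ)|) := by gcongr
    _ = ‖C‖ * Real.exp (ε * N) * ((|(n : ℝ)| + N) ^ j * Real.exp (-ε * |(n : ℝ)|)) := by
      rw [Real.exp_add]
      ring

lemma greenUpper_eq_expSeries (k α : ℝ) :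
    greenUpper k α = expSeries (fun n => Complex.I * ((n : ℂ) + α))
      (fun n => Complex.I * greenBeta k α n)
      (fun n => Complex.I / (4 * (Real.pi : ℂ)) * (1 / greenBeta k α n)) := by
  funext x
  rw [greenUpper, expSeries, ← tsum_mul_left]
  refine tsum_congr fun n => ?_
  push_cast
  ring_nf

/-- The function `g(x) = (i/(4π)) Σ_n (1/β_n) exp(iα_n x₁ + iβ_n x₂)` is
infinitely differentiable on the open upper half-plane and satisfies the Helmholtz equation
`∂²g/∂x₁² + ∂²g/∂x₂² + k² g = 0` there. -/
theorem greenUpper_smooth_and_helmholtz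
    (k α : ℝ) (hk : 0 < k)
    (hres : ∀ n : ℤ, k ^ 2 ≠ ((n : ℝ) + α) ^ 2) :
    ContDiffOn ℝ (⊤ : ℕ∞) (greenUpper k α) {x : ℝ × ℝ | 0 < x.2} ∧
    ∀ x : ℝ × ℝ, 0 < x.2 →
      deriv (deriv (fun s : ℝ => greenUpper k α (s, x.2))) x.1 +
        deriv (deriv (fun t : ℝ => greenUpper k α (x.1, t))) x.2 +
        ((k : ℂ)) ^ 2 * greenUpper k α x = 0 := by
  have ha : ∀ n : ℤ, (Complex.I * ((n : ℂ) + α)).re = 0 := fun n => by simp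
  have hb := re_I_mul_greenBeta_nonpos k α
  have haw : ∀ n : ℤ, ‖Complex.I * ((n : ℂ) + α)‖ ≤ |(n : ℝ) + α| + k := fun n => by
    have : ‖(n : ℂ) + α‖ = |(n : ℝ) + α| := by
      rw [← Real.norm_eq_abs, ← Complex.norm_real]
      push_cast
      rfl
    simpa [this] using hk.le
  have hbw : ∀ n : ℤ, ‖Complex.I * greenBeta k α n‖ ≤ |(n : ℝ) + α| + k := fun n => by
    simpa using norm_greenBeta_le hk α n
  have hc := rapidDecay_greenBeta hk α (Complex.I / (4 * (Real.pi : ℂ)))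
  rw [greenUpper_eq_expSeries]
  refine ⟨contDiffOn_infty.2 fun m => contDiffOn_expSeries ha hb haw hbw m _ hc,
    fun x hx => expSeries_helmholtz hc ha hb haw hbw (fun n => ?_) hx⟩
  rw [mul_pow, mul_pow, greenBeta_sq, Complex.I_sq]
  ring
end
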